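/- Representatives of the Hamming (n,ℓ,σ)-equivalence classes. Let 0 < ℓ < n be integers, set d₀ := gcd([n]_r, q−1), d_ℓ := gcd([n−ℓ]_r, q−1) and d := gcd( (q−1)/d₀, (q−1)/d_ℓ ). Then for every pair (a₀, a_ℓ) of nonzero elements of 𝔽_q there exist natural numbers i < d₀, j < d_ℓ, h < d and a nonzero α ∈ 𝔽_q such that a₀·N_n^σ(α) = ξ^{i + h·[n]_r} and a_ℓ·N_{n−ℓ}^σ(σ^ℓ(α)) = ξ^{j}. -/

import Mathlib

/-- `sNorm σ i α = σ^{i-1}(α) ⋯ σ(α) · α`, the `i`-th skew norm of `α`. -/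
def sNorm {F : Type*} [Field F] (σ : F ≃+* F) (i : ℕ) (α : F) : F :=
  ∏ j ∈ Finset.range i, (⇑σ)^[j] α

/-- `brk p r i = [i]_r = 1 + p^r + ⋯ + p^{r(i-1)} = (p^{ri} - 1)/(p^r - 1)`. -/
def brk (p r i : ℕ) : ℕ := ∑ j ∈ Finset.range i, p ^ (r * j)

/-- Every integer is congruent modulo `M` to `i + A * y` for some `0 ≤ i < gcd A M`. -/
theorem exists_add_mul_dvd_sub (A M : ℕ) (hM : 0 < M) (u : ℤ) :
    ∃ (i : ℕ) (y : ℤ), i < Nat.gcd A M ∧ (M : ℤ) ∣ u - (i + A * y) := by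
  have hg : (0 : ℤ) < Nat.gcd A M := by exact_mod_cast Nat.gcd_pos_of_pos_right A hM
  refine ⟨(u % Nat.gcd A M).toNat, Nat.gcdA A M * (u / Nat.gcd A M), ?_,
    Nat.gcdB A M * (u / Nat.gcd A M), ?_⟩
  · have := Int.emod_lt_of_pos u hg
    have := Int.emod_nonneg u hg.ne'
    omega
  · rw [Int.toNat_of_nonneg (Int.emod_nonneg u hg.ne')]
    linear_combination -Int.emod_add_mul_ediv u (Nat.gcd A M) +
      (u / Nat.gcd A M) * Nat.gcd_eq_gcd_ab A M

theorem dvd_mul_div_gcd (A M : ℕ) : M ∣ A * (M / Nat.gcd A M) := by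
  rw [← Nat.mul_div_assoc A (Nat.gcd_dvd_right A M), mul_comm A M,
    Nat.mul_div_assoc M (Nat.gcd_dvd_left A M)]
  exact dvd_mul_right _ _

/-- Normal form of a pair of exponents modulo `M` under simultaneous translation by
`(A * x, B * x)`. -/
theorem exists_simultaneous_translate (A B M : ℕ) (hM : 0 < M) (u v : ℤ) :
    ∃ (i j h : ℕ) (x : ℤ), i < Nat.gcd A M ∧ j < Nat.gcd B M ∧
      h < Nat.gcd (M / Nat.gcd A M) (M / Nat.gcd B M) ∧
      (M : ℤ) ∣ (u + A * x) - (i + h * A) ∧ (M : ℤ) ∣ (v + B * x) - j := by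
  obtain ⟨i, y, hi, hy⟩ := exists_add_mul_dvd_sub A M hM u
  obtain ⟨j, z, hj, hz⟩ := exists_add_mul_dvd_sub B M hM v
  have hA : (M : ℤ) ∣ A * (M / Nat.gcd A M : ℕ) := by exact_mod_cast dvd_mul_div_gcd A M
  have hB : (M : ℤ) ∣ B * (M / Nat.gcd B M : ℕ) := by exact_mod_cast dvd_mul_div_gcd B M
  have hM₀ : 0 < M / Nat.gcd A M :=
    Nat.div_pos (Nat.gcd_le_right A hM) (Nat.gcd_pos_of_pos_right A hM)
  generalize M / Nat.gcd A M = M₀ at *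
  generalize M / Nat.gcd B M = M₁ at *
  -- `h` is the residue of `y - z` modulo `gcd M₀ M₁`
  obtain ⟨h, k, hh, w, hw⟩ := exists_add_mul_dvd_sub 0 (Nat.gcd M₀ M₁)
    (Nat.gcd_pos_of_pos_left M₁ hM₀) (y - z)
  rw [Nat.gcd_zero_left] at hh
  have hbez := Nat.gcd_eq_gcd_ab M₀ M₁
  push_cast at hw
  refine ⟨i, j, h, h - y + M₀ * (Nat.gcdA M₀ M₁ * w), hi, hj, hh, ?_, ?_⟩
  · refine (dvd_add hy (hA.mul_right (Nat.gcdA M₀ M₁ * w))).trans (dvd_of_eq ?_)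
    ring
  · refine (dvd_sub hz (hB.mul_right (Nat.gcdB M₀ M₁ * w))).trans (dvd_of_eq ?_)
    linear_combination (B : ℤ) * hw + B * w * hbez

theorem iterate_eq_pow_of_eq_pow {G : Type*} [Monoid G] {f : G → G} {p r : ℕ}
    (hf : ∀ a, f a = a ^ p ^ r) (j : ℕ) (a : G) : f^[j] a = a ^ p ^ (r * j) := by
  induction j with
  | zero => simp
  | succ j ih => rw [Function.iterate_succ_apply', ih, hf, ← pow_mul, ← pow_add, mul_add_one]

theorem sNorm_eq_pow_brk {F : Type*} [Field F] {σ : F ≃+* F} {p r : ℕ}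
    (hσ : ∀ a : F, σ a = a ^ p ^ r) (i : ℕ) (α : F) : sNorm σ i α = α ^ brk p r i := by
  simp only [sNorm, brk, iterate_eq_pow_of_eq_pow hσ, Finset.prod_pow_eq_pow_sum]

theorem zpow_eq_zpow_of_card_sub_one_dvd_sub {F : Type*} [Field F] [Fintype F] {ξ : F}
    (hξ : ξ ≠ 0) {a b : ℤ} (h : ((Fintype.card F - 1 : ℕ) : ℤ) ∣ a - b) : ξ ^ a = ξ ^ b := by
  obtain ⟨k, hk⟩ := h
  rw [← sub_add_cancel a b, hk, zpow_add₀ hξ, zpow_mul, zpow_natCast,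
    FiniteField.pow_card_sub_one_eq_one ξ hξ, one_zpow, one_mul]

/-- Representatives of the Hamming `(n,ℓ,σ)`-equivalence classes. -/
theorem hamming_equiv_representatives
    (p s r : ℕ) (hp : p.Prime) (hs : 1 ≤ s) (hr : r < s)
    (F : Type*) [Field F] [Fintype F] (hF : Fintype.card F = p ^ s)
    (σ : F ≃+* F) (hσ : ∀ a : F, σ a = a ^ p ^ r)
    (ξ : F) (hξ0 : ξ ≠ 0) (hξ : ∀ x : F, x ≠ 0 → ∃ m : ℕ, x = ξ ^ m)
    (ℓ n : ℕ) (hℓ : 0 < ℓ) (hℓn : ℓ < n)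
    (d₀ dℓ d : ℕ)
    (hd₀ : d₀ = Nat.gcd (brk p r n) (p ^ s - 1))
    (hdℓ : dℓ = Nat.gcd (brk p r (n - ℓ)) (p ^ s - 1))
    (hd : d = Nat.gcd ((p ^ s - 1) / d₀) ((p ^ s - 1) / dℓ))
    (a₀ aℓ : F) (ha₀ : a₀ ≠ 0) (haℓ : aℓ ≠ 0) :
    ∃ (i j h : ℕ) (α : F), i < d₀ ∧ j < dℓ ∧ h < d ∧ α ≠ 0 ∧
      a₀ * sNorm σ n α = ξ ^ (i + h * brk p r n) ∧
      aℓ * sNorm σ (n - ℓ) ((⇑σ)^[ℓ] α) = ξ ^ j := by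
  have hM : 0 < p ^ s - 1 := Nat.sub_pos_of_lt (Nat.one_lt_pow (by omega) hp.one_lt)
  have hcop : Nat.Coprime (p ^ (r * ℓ)) (p ^ s - 1) := by
    refine Nat.Coprime.pow_left _ (Nat.Coprime.coprime_dvd_left
      (dvd_pow_self p (n := s) (by omega)) ?_)
    exact (Nat.coprime_self_sub_right (Nat.one_le_pow _ _ hp.pos)).2 (Nat.coprime_one_right _)
  obtain ⟨u, rfl⟩ := hξ a₀ ha₀
  obtain ⟨v, rfl⟩ := hξ aℓ haℓ
  obtain ⟨i, j, h, x, hi, hj, hh, hu, hv⟩ := exists_simultaneous_translate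
    (brk p r n) (p ^ (r * ℓ) * brk p r (n - ℓ)) (p ^ s - 1) hM u v
  rw [hcop.gcd_mul_left_cancel] at hj hh
  rw [← hdℓ] at hj hh
  rw [← hd₀] at hi hh
  rw [← hd] at hh
  rw [← hF] at hu hv
  refine ⟨i, j, h, ξ ^ x, hi, hj, hh, zpow_ne_zero x hξ0, ?_, ?_⟩
  · have := zpow_eq_zpow_of_card_sub_one_dvd_sub hξ0 hu
    rw [sNorm_eq_pow_brk hσ, ← zpow_natCast, ← zpow_natCast, ← zpow_natCast, ← zpow_mul,
      ← zpow_add₀ hξ0, mul_comm x]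
    exact_mod_cast this
  · have := zpow_eq_zpow_of_card_sub_one_dvd_sub hξ0 hv
    rw [sNorm_eq_pow_brk hσ, iterate_eq_pow_of_eq_pow hσ, ← pow_mul, ← zpow_natCast,
      ← zpow_natCast, ← zpow_natCast, ← zpow_mul, ← zpow_add₀ hξ0, mul_comm x]
    exact_mod_cast this
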